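/- arXiv:1612.07063 — 4 statements merged into one kernel-verified Lean document; each statement's English description precedes it below -/
import Mathlib

section
/- Let M be an almost trans-S-manifold with structure (f, ξ_1, …, ξ_s, η_1, …, η_s, g) and Levi-Civita connection ∇. Then for all vector fields X, Y on M: [f,f](X,Y) + 2 Σ_{i=1}^s dη_i(X,Y) ξ_i = Σ_{i,j=1}^s [η_j(∇_X ξ_i) η_j(Y) − η_j(∇_Y ξ_i) η_j(X)] ξ_i, where [f,f] denotes the Nijenhuis tensor of f. -/
open scoped BigOperators

noncomputable section

/-- An abstract model of the algebra of smooth real-valued functions `C` of a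
manifold together with its Lie algebra `V` of smooth vector fields: each vector
field acts on functions as a derivation, compatibly with the module structure
and the Lie bracket. -/
structure DiffModel (C V : Type) [CommRing C] [Algebra ℝ C]
    [LieRing V] [Module C V] where
  act : V → C → C
  act_add_left : ∀ (X Y : V) (a : C), act (X + Y) a = act X a + act Y a
  act_smul_left : ∀ (c : C) (X : V) (a : C), act (c • X) a = c * act X a
  act_add : ∀ (X : V) (a b : C), act X (a + b) = act X a + act X b
  act_mul : ∀ (X : V) (a b : C), act X (a * b) = act X a * b + a * act X b
  act_const : ∀ (X : V) (r : ℝ), act X ((algebraMap ℝ C) r) = 0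
  act_bracket : ∀ (X Y : V) (a : C),
    act ⁅X, Y⁆ a = act X (act Y a) - act Y (act X a)
  bracket_smul_right : ∀ (X : V) (c : C) (Y : V),
    ⁅X, c • Y⁆ = act X c • Y + c • ⁅X, Y⁆

/-- A Riemannian metric together with its Levi-Civita connection on the
abstract model `D` of the vector fields of a manifold. -/
structure RiemStr {C V : Type} [CommRing C] [Algebra ℝ C]
    [LieRing V] [Module C V] (D : DiffModel C V) where
  g : V → V → C
  conn : V → V → V
  g_symm : ∀ X Y, g X Y = g Y X
  g_add_left : ∀ X Y Z, g (X + Y) Z = g X Z + g Y Z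
  g_smul_left : ∀ (c : C) (X Y : V), g (c • X) Y = c * g X Y
  conn_add_left : ∀ X Y Z, conn (X + Y) Z = conn X Z + conn Y Z
  conn_smul_left : ∀ (c : C) (X Y : V), conn (c • X) Y = c • conn X Y
  conn_add_right : ∀ X Y Z, conn X (Y + Z) = conn X Y + conn X Z
  conn_smul_right : ∀ (X : V) (c : C) (Y : V),
    conn X (c • Y) = D.act X c • Y + c • conn X Y
  torsion_free : ∀ X Y, conn X Y - conn Y X = ⁅X, Y⁆
  metric_compat : ∀ X Y Z, D.act X (g Y Z) = g (conn X Y) Z + g Y (conn X Z)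

/-- An `f`-structure with `s` structure vector fields `ξ i` and dual `1`-forms
`η i` on the abstract model of the vector fields of a manifold:
`f` is a `(1,1)`-tensor field with `f ∘ f ∘ f + f = 0`, `f (ξ i) = 0`,
`η i ∘ f = 0`, `η i (ξ j) = δ i j` and `f² = -id + Σ η i ⊗ ξ i`. -/
structure FStr (C V : Type) [CommRing C] [Algebra ℝ C]
    [LieRing V] [Module C V] (s : ℕ) where
  f : V → V
  ξ : Fin s → V
  η : Fin s → V → C
  f_add : ∀ X Y, f (X + Y) = f X + f Y
  f_smul : ∀ (c : C) (X : V), f (c • X) = c • f X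
  η_add : ∀ i X Y, η i (X + Y) = η i X + η i Y
  η_smul : ∀ i (c : C) (X : V), η i (c • X) = c * η i X
  f_cube : ∀ X, f (f (f X)) + f X = 0
  f_ξ : ∀ i, f (ξ i) = 0
  η_f : ∀ i X, η i (f X) = 0
  η_ξ : ∀ i j, η i (ξ j) = if i = j then (1 : C) else 0
  f_sq : ∀ X, f (f X) = -X + ∑ i, η i X • ξ i

section Defs

variable {C V : Type} [CommRing C] [Algebra ℝ C] [LieRing V] [Module C V] {s : ℕ}

/-- The compatibility of the metric with the `f`-structure:
`g(X,Y) = g(fX,fY) + Σ η i (X) η i (Y)`.  A metric `f`-manifold is the data of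
`D`, `R`, `S` satisfying `MetricCompat D R S`. -/
def MetricCompat (D : DiffModel C V) (R : RiemStr D) (S : FStr C V s) : Prop :=
  ∀ X Y, R.g X Y = R.g (S.f X) (S.f Y) + ∑ i, S.η i X * S.η i Y

/-- The covariant derivative `(∇_X f) Y` of the tensor field `f`. -/
def nablaF (D : DiffModel C V) (R : RiemStr D) (S : FStr C V s) (X Y : V) : V :=
  R.conn X (S.f Y) - S.f (R.conn X Y)

/-- The Nijenhuis tensor `[f,f]` of `f`. -/
def nijenhuis (S : FStr C V s) (X Y : V) : V :=
  S.f (S.f ⁅X, Y⁆) + ⁅S.f X, S.f Y⁆ - S.f ⁅S.f X, Y⁆ - S.f ⁅X, S.f Y⁆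

/-- The exterior differential of a `1`-form,
`dθ(X,Y) = ½ (X θ(Y) - Y θ(X) - θ([X,Y]))`. -/
def dOne (D : DiffModel C V) (θ : V → C) (X Y : V) : C :=
  algebraMap ℝ C (1 / 2) * (D.act X (θ Y) - D.act Y (θ X) - θ ⁅X, Y⁆)

/-- The exterior differential of a `2`-form. -/
def dTwo (D : DiffModel C V) (ω : V → V → C) (X Y Z : V) : C :=
  D.act X (ω Y Z) - D.act Y (ω X Z) + D.act Z (ω X Y)
    - ω ⁅X, Y⁆ Z + ω ⁅X, Z⁆ Y - ω ⁅Y, Z⁆ X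

/-- The fundamental `2`-form `F(X,Y) = g(X, fY)` of a metric `f`-manifold. -/
def Fform (D : DiffModel C V) (R : RiemStr D) (S : FStr C V s) (X Y : V) : C :=
  R.g X (S.f Y)

/-- Normality of an `f`-structure: `[f,f] + 2 Σ dη i ⊗ ξ i = 0`. -/
def IsNormal (D : DiffModel C V) (S : FStr C V s) : Prop :=
  ∀ X Y, nijenhuis S X Y + (2 : C) • ∑ i, dOne D (S.η i) X Y • S.ξ i = 0

/-- The almost trans-`S` condition with characteristic functions `α i`, `β i`:
`(∇_X f)Y = Σ [α i {g(fX,fY) ξ i + η i (Y) f²X} + β i {g(fX,Y) ξ i − η i (Y) fX}]`. -/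
def IsAlmostTransS (D : DiffModel C V) (R : RiemStr D) (S : FStr C V s)
    (α β : Fin s → C) : Prop :=
  ∀ X Y, nablaF D R S X Y =
    ∑ i, (α i • (R.g (S.f X) (S.f Y) • S.ξ i + S.η i Y • S.f (S.f X))
        + β i • (R.g (S.f X) Y • S.ξ i - S.η i Y • S.f X))

/-- A trans-`S`-manifold is a normal almost trans-`S`-manifold. -/
def IsTransS (D : DiffModel C V) (R : RiemStr D) (S : FStr C V s)
    (α β : Fin s → C) : Prop :=
  IsAlmostTransS D R S α β ∧ IsNormal D S

/-- A `K`-manifold: normal with closed fundamental `2`-form. -/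
def IsK (D : DiffModel C V) (R : RiemStr D) (S : FStr C V s) : Prop :=
  IsNormal D S ∧ ∀ X Y Z, dTwo D (Fform D R S) X Y Z = 0

/-- An `S`-manifold: a `K`-manifold with `F = dη i` for every `i`. -/
def IsSman (D : DiffModel C V) (R : RiemStr D) (S : FStr C V s) : Prop :=
  IsK D R S ∧ ∀ i X Y, Fform D R S X Y = dOne D (S.η i) X Y

/-- A `C`-manifold: a `K`-manifold with `dη i = 0` for every `i`. -/
def IsCman (D : DiffModel C V) (R : RiemStr D) (S : FStr C V s) : Prop :=
  IsK D R S ∧ ∀ (i : Fin s) X Y, dOne D (S.η i) X Y = 0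

/-- The covariant derivative `(∇_X ω)(Y,Z)` of a `2`-form. -/
def covTwo (D : DiffModel C V) (R : RiemStr D) (ω : V → V → C) (X Y Z : V) : C :=
  D.act X (ω Y Z) - ω (R.conn X Y) Z - ω Y (R.conn X Z)

/-- The covariant derivative `(∇_X θ)(Y)` of a `1`-form. -/
def covOne (D : DiffModel C V) (R : RiemStr D) (θ : V → C) (X Y : V) : C :=
  D.act X (θ Y) - θ (R.conn X Y)

/-- A global `f`-basis `{X_1,…,X_n, fX_1,…,fX_n, ξ_1,…,ξ_s}` of a
`(2n+s)`-dimensional metric `f`-manifold. -/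
structure FBasis (D : DiffModel C V) (R : RiemStr D) (S : FStr C V s)
    (n : ℕ) where
  e : Fin n → V
  orth : ∀ k l, R.g (e k) (e l) = if k = l then (1 : C) else 0
  orth_f : ∀ k l, R.g (e k) (S.f (e l)) = 0
  horiz : ∀ i k, S.η i (e k) = 0
  span : ∀ X : V, X = ∑ k, R.g X (e k) • e k
      + ∑ k, R.g X (S.f (e k)) • S.f (e k) + ∑ i, S.η i X • S.ξ i

/-- The codifferential `δω` of a `2`-form, computed in an `f`-basis:
`(δω)(X) = -Σ_k [(∇_{X_k}ω)(X_k,X) + (∇_{fX_k}ω)(fX_k,X)] - Σ_j (∇_{ξ_j}ω)(ξ_j,X)`. -/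
def codiffTwo {n : ℕ} (D : DiffModel C V) (R : RiemStr D) (S : FStr C V s)
    (B : FBasis D R S n) (ω : V → V → C) (X : V) : C :=
  -(∑ k, (covTwo D R ω (B.e k) (B.e k) X
      + covTwo D R ω (S.f (B.e k)) (S.f (B.e k)) X))
    - ∑ j, covTwo D R ω (S.ξ j) (S.ξ j) X

/-- The codifferential `δθ` of a `1`-form, computed in an `f`-basis. -/
def codiffOne {n : ℕ} (D : DiffModel C V) (R : RiemStr D) (S : FStr C V s)
    (B : FBasis D R S n) (θ : V → C) : C :=
  -(∑ k, (covOne D R θ (B.e k) (B.e k)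
      + covOne D R θ (S.f (B.e k)) (S.f (B.e k))))
    - ∑ j, covOne D R θ (S.ξ j) (S.ξ j)

/-- The Lie derivative of the metric along `ξ`:
`(L_ξ g)(X,Y) = ξ g(X,Y) - g([ξ,X],Y) - g(X,[ξ,Y])`. -/
def lieDerivG (D : DiffModel C V) (R : RiemStr D) (ξ X Y : V) : C :=
  D.act ξ (R.g X Y) - R.g ⁅ξ, X⁆ Y - R.g X ⁅ξ, Y⁆

end Defs

/-- In an almost trans-`S`-manifold,
`[f,f](X,Y) + 2 Σ_i dη_i(X,Y) ξ_i
  = Σ_{i,j} [η_j(∇_X ξ_i) η_j(Y) − η_j(∇_Y ξ_i) η_j(X)] ξ_i`. -/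
theorem almost_transS_normality_tensor
    {C V : Type} [CommRing C] [Algebra ℝ C] [LieRing V] [Module C V]
    {s : ℕ} (D : DiffModel C V) (R : RiemStr D) (S : FStr C V s)
    (hcompat : MetricCompat D R S) (α β : Fin s → C)
    (hM : IsAlmostTransS D R S α β) :
    ∀ X Y : V,
      nijenhuis S X Y + (2 : C) • ∑ i, dOne D (S.η i) X Y • S.ξ i =
        ∑ i, (∑ j, (S.η j (R.conn X (S.ξ i)) * S.η j Y
          - S.η j (R.conn Y (S.ξ i)) * S.η j X)) • S.ξ i := by
  intro X Y
  let F : V →ₗ[C] V := { toFun := S.f, map_add' := S.f_add, map_smul' := S.f_smul }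
  have f_sub : ∀ X Y, S.f (X - Y) = S.f X - S.f Y := fun X Y => map_sub F X Y
  have f_neg : ∀ X, S.f (-X) = - S.f X := fun X => map_neg F X
  have f_sum : ∀ v : Fin s → V, S.f (∑ i, v i) = ∑ i, S.f (v i) := fun v => map_sum F v _
  have f_zero : S.f 0 = 0 := map_zero F
  let G : V → V →ₗ[C] C := fun Z =>
    { toFun := fun W => R.g W Z, map_add' := fun A B => R.g_add_left A B Z,
      map_smul' := fun c A => R.g_smul_left c A Z }
  have g_sub : ∀ A B Z, R.g (A - B) Z = R.g A Z - R.g B Z := fun A B Z => map_sub (G Z) A B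
  have g_neg : ∀ A Z, R.g (-A) Z = - R.g A Z := fun A Z => map_neg (G Z) A
  have g_zero : ∀ Z, R.g 0 Z = 0 := fun Z => map_zero (G Z)
  have g_sum : ∀ (v : Fin s → V) Z, R.g (∑ i, v i) Z = ∑ i, R.g (v i) Z :=
    fun v Z => map_sum (G Z) v _
  let H : Fin s → V →ₗ[C] C := fun i =>
    { toFun := S.η i, map_add' := S.η_add i, map_smul' := S.η_smul i }
  have η_sub : ∀ i A B, S.η i (A - B) = S.η i A - S.η i B := fun i A B => map_sub (H i) A B
  have g_ξ : ∀ i A, R.g (S.ξ i) A = S.η i A := by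
    intro i A
    rw [hcompat, S.f_ξ, g_zero]
    simp [S.η_ξ]
  have g_ξ' : ∀ i A, R.g A (S.ξ i) = S.η i A := by
    intro i A
    rw [R.g_symm, g_ξ]
  have f_cube : ∀ A, S.f (S.f (S.f A)) = - S.f A := fun A => eq_neg_of_add_eq_zero_left (S.f_cube A)
  have skew : ∀ A B, R.g (S.f A) B = - R.g (S.f B) A := by
    intro A B
    rw [hcompat, S.f_sq, R.g_add_left, g_neg, g_sum]
    simp [S.η_f, R.g_smul_left, g_ξ]
    exact R.g_symm _ _
  have sq_symm : ∀ A B, R.g (S.f (S.f A)) B = R.g (S.f (S.f B)) A := by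
    intro A B
    rw [skew, R.g_symm, skew (S.f B) A]
  -- the covariant derivative of the structure fields
  have nab : ∀ A i B, R.g (R.conn A (S.ξ i)) B =
      ∑ j, S.η j (R.conn A (S.ξ i)) * S.η j B - α i * R.g (S.f A) B
        - β i * R.g (S.f (S.f A)) B := by
    intro A i B
    have h := hM A (S.ξ i)
    have h2 : - S.f (R.conn A (S.ξ i)) = α i • S.f (S.f A) - β i • S.f A := by
      have h0 : R.conn A 0 = 0 := by
        have := R.conn_add_right A 0 0
        simpa using this
      have gz : ∀ Z, R.g Z 0 = 0 := fun Z => by rw [R.g_symm, g_zero]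
      rw [nablaF, S.f_ξ, h0, zero_sub] at h
      rw [h]
      simp [gz, g_ξ', S.η_f, S.η_ξ, Finset.sum_add_distrib, sub_eq_add_neg]
    have h3 := congrArg S.f h2
    rw [f_neg, S.f_sq, f_sub, S.f_smul, S.f_smul, f_cube] at h3
    have h4 := congrArg (fun Z => R.g Z B) h3
    simp only [g_neg, R.g_add_left, g_sum, g_sub, R.g_smul_left, g_ξ] at h4
    linear_combination h4
  have key : ∀ A B, nablaF D R S (S.f A) B - S.f (nablaF D R S A B) =
      ∑ i, (α i * R.g (S.f (S.f A)) (S.f B) + β i * R.g (S.f (S.f A)) B) • S.ξ i := by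
    intro A B
    rw [hM, hM, f_sum, ← Finset.sum_sub_distrib]
    refine Finset.sum_congr rfl fun i _ => ?_
    simp only [S.f_add, S.f_smul, f_sub, S.f_ξ]
    module
  have hN : nijenhuis S X Y = (nablaF D R S (S.f X) Y - S.f (nablaF D R S X Y))
      - (nablaF D R S (S.f Y) X - S.f (nablaF D R S Y X)) := by
    simp only [nijenhuis, nablaF, ← R.torsion_free, f_sub]
    abel
  have half : (2 : C) * algebraMap ℝ C (1 / 2) = 1 := by
    have : (2 : C) = algebraMap ℝ C 2 := (map_ofNat (algebraMap ℝ C) 2).symm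
    rw [this, ← map_mul]
    norm_num
  have hd : ∀ i, (2 : C) * dOne D (S.η i) X Y =
      R.g (R.conn X (S.ξ i)) Y - R.g (R.conn Y (S.ξ i)) X := by
    intro i
    have a1 := R.metric_compat X (S.ξ i) Y
    have a2 := R.metric_compat Y (S.ξ i) X
    rw [g_ξ, g_ξ] at a1 a2
    rw [dOne, ← mul_assoc, half, ← R.torsion_free, η_sub]
    linear_combination a1 - a2
  rw [hN, key, key, Finset.smul_sum, ← Finset.sum_sub_distrib, ← Finset.sum_add_distrib]
  refine Finset.sum_congr rfl fun i _ => ?_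
  rw [smul_smul, hd, ← sub_smul, ← add_smul, nab, nab, Finset.sum_sub_distrib]
  congr 1
  have e1 : R.g (S.f (S.f X)) (S.f Y) = R.g (S.f X) Y := by
    rw [hcompat (S.f X) Y]
    simp [S.η_f]
  have e2 : R.g (S.f (S.f Y)) (S.f X) = - R.g (S.f X) Y := by
    rw [skew X Y, hcompat (S.f Y) X]
    simp [S.η_f]
  rw [e1, e2, sq_symm Y X, skew Y X]
  ring
end
end

section
/- Let M be a trans-S-manifold with structure (f, ξ_1, …, ξ_s, η_1, …, η_s, g) and Levi-Civita connection ∇. Then η_k(∇_X ξ_i) = 0 for every vector field X on M and all i, k = 1, …, s. -/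
open scoped BigOperators

noncomputable section

/-- In a trans-`S`-manifold, `η_k (∇_X ξ_i) = 0` for every
vector field `X` and all `i, k`. -/
theorem transS_eta_conn_xi
    {C V : Type} [CommRing C] [Algebra ℝ C] [LieRing V] [Module C V]
    {s : ℕ} (D : DiffModel C V) (R : RiemStr D) (S : FStr C V s)
    (hcompat : MetricCompat D R S) (α β : Fin s → C)
    (hM : IsTransS D R S α β) :
    ∀ (X : V) (i k : Fin s), S.η k (R.conn X (S.ξ i)) = 0 := by
  obtain ⟨hA, hN⟩ := hM
  have half : algebraMap ℝ C (1/2) * 2 = 1 := by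
    have : (2 : C) = algebraMap ℝ C 2 := (map_ofNat (algebraMap ℝ C) 2).symm
    rw [this, ← map_mul]; norm_num
  have two_cancel : ∀ a : C, a + a = 0 → a = 0 := by
    intro a h
    linear_combination (algebraMap ℝ C (1/2)) * h - a * half
  have f0 : S.f 0 = 0 := by simpa using S.f_smul 0 0
  have η0 : ∀ k, S.η k 0 = 0 := fun k => by simpa using S.η_smul k 0 0
  have g0l : ∀ Y, R.g 0 Y = 0 := fun Y => by simpa using R.g_smul_left 0 0 Y
  have g0r : ∀ Y, R.g Y 0 = 0 := fun Y => by rw [R.g_symm, g0l]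
  have fneg : ∀ X, S.f (-X) = - S.f X := fun X => by simpa using S.f_smul (-1) X
  have ηneg : ∀ k X, S.η k (-X) = - S.η k X := fun k X => by simpa using S.η_smul k (-1) X
  have ηsub : ∀ k X Y, S.η k (X - Y) = S.η k X - S.η k Y := fun k X Y => by
    rw [sub_eq_add_neg, S.η_add, ηneg, sub_eq_add_neg]
  have act1 : ∀ X, D.act X 1 = 0 := fun X => by simpa using D.act_const X 1
  have act0 : ∀ X, D.act X 0 = 0 := fun X => by simpa using D.act_const X 0
  have hη : ∀ X k, R.g X (S.ξ k) = S.η k X := by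
    intro X k
    rw [hcompat, S.f_ξ, g0r]
    simp [S.η_ξ]
  have actηξ : ∀ X i k, D.act X (S.η i (S.ξ k)) = 0 := by
    intro X i k
    rw [S.η_ξ]; split_ifs
    · exact act1 X
    · exact act0 X
  have anti : ∀ X i k, S.η k (R.conn X (S.ξ i)) + S.η i (R.conn X (S.ξ k)) = 0 := by
    intro X i k
    have h := R.metric_compat X (S.ξ i) (S.ξ k)
    rw [hη, actηξ, hη, R.g_symm, hη] at h
    exact h.symm
  have fconn : ∀ i j, S.f (R.conn (S.ξ i) (S.ξ j)) = 0 := by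
    intro i j
    have h := hA (S.ξ i) (S.ξ j)
    simpa [nablaF, S.f_ξ, f0, g0l, (by simpa using R.conn_smul_right (S.ξ i) 0 (0:V) : R.conn (S.ξ i) 0 = D.act (S.ξ i) 0 • 0 + 0), act0] using h
  have ηsum : ∀ k (c : Fin s → C), S.η k (∑ i, c i • S.ξ i) = c k := by
    intro k c
    let L : V →ₗ[C] C := ⟨⟨S.η k, S.η_add k⟩, fun c X => S.η_smul k c X⟩
    have h : L (∑ i, c i • S.ξ i) = ∑ i, c i * S.η k (S.ξ i) := by
      rw [map_sum]; exact Finset.sum_congr rfl fun i _ => S.η_smul k _ _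
    change L _ = _
    rw [h]; simp [S.η_ξ]
  have hd : ∀ X j k, D.act (S.ξ j) (S.η k X) + S.η k ⁅X, S.ξ j⁆ = 0 := by
    intro X j k
    have h := congrArg (S.η k) (hN X (S.ξ j))
    rw [S.η_add, S.η_smul, ηsum, η0] at h
    simp only [nijenhuis, dOne, S.f_ξ, lie_zero, f0, ηsub, S.η_add, S.η_f, η0, actηξ] at h
    linear_combination -h - (D.act (S.ξ j) (S.η k X) + S.η k ⁅X, S.ξ j⁆) * half
  have key : ∀ X j k, S.η j (R.conn X (S.ξ k)) = R.g X (R.conn (S.ξ j) (S.ξ k)) := by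
    intro X j k
    have h := hd X j k
    rw [← R.torsion_free, ηsub, ← hη X k, R.metric_compat, hη] at h
    linear_combination anti X k j - h
  have vert : ∀ i j k, S.η j (R.conn (S.ξ i) (S.ξ k)) = 0 := by
    have sym : ∀ i j k, S.η j (R.conn (S.ξ i) (S.ξ k)) = S.η i (R.conn (S.ξ j) (S.ξ k)) := by
      intro i j k
      rw [key, R.g_symm, hη]
    intro i j k
    apply two_cancel
    linear_combination anti (S.ξ i) k j - sym i k j - anti (S.ξ k) j i + sym k j i
      + anti (S.ξ j) i k + sym i j k
  have z : ∀ j k, R.conn (S.ξ j) (S.ξ k) = 0 := by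
    intro j k
    have h := S.f_sq (R.conn (S.ξ j) (S.ξ k))
    simpa [fconn, f0, vert] using h
  intro X i k
  rw [key, z, g0r]
end
end

section
/- Let M be a trans-S-manifold with structure (f, ξ_1, …, ξ_s, η_1, …, η_s, g), characteristic functions α_i, β_i, and Levi-Civita connection ∇. Then ∇_X ξ_i = −α_i fX − β_i f^2 X for every vector field X on M and every i = 1, …, s. -/
open scoped BigOperators

noncomputable section

/-- In a trans-`S`-manifold with characteristic functions
`α_i, β_i`, one has `∇_X ξ_i = −α_i fX − β_i f²X`. -/
theorem transS_conn_xi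
    {C V : Type} [CommRing C] [Algebra ℝ C] [LieRing V] [Module C V]
    {s : ℕ} (D : DiffModel C V) (R : RiemStr D) (S : FStr C V s)
    (hcompat : MetricCompat D R S) (α β : Fin s → C)
    (hM : IsTransS D R S α β) :
    ∀ (X : V) (i : Fin s),
      R.conn X (S.ξ i) = -(α i • S.f X) - β i • S.f (S.f X) := by
  obtain ⟨hA, hN⟩ := hM
  have half : algebraMap ℝ C (1/2) * 2 = 1 := by
    rw [← map_ofNat (algebraMap ℝ C) 2, ← map_mul]; norm_num
  have two_zero : ∀ a : C, 2 * a = 0 → a = 0 := by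
    intro a h
    have : algebraMap ℝ C (1/2) * (2 * a) = a := by rw [← mul_assoc, half, one_mul]
    rw [← this, h, mul_zero]
  have f0 : S.f 0 = 0 := by simpa using S.f_smul 0 0
  have fneg : ∀ X, S.f (-X) = - S.f X := fun X => by simpa using S.f_smul (-1) X
  have fsub : ∀ X Y, S.f (X - Y) = S.f X - S.f Y := fun X Y => by
    rw [sub_eq_add_neg, S.f_add, fneg, sub_eq_add_neg]
  have e0 : ∀ i, S.η i 0 = 0 := fun i => by simpa using S.η_smul i 0 0
  have eneg : ∀ i X, S.η i (-X) = - S.η i X := fun i X => by simpa using S.η_smul i (-1) X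
  have esub : ∀ i X Y, S.η i (X - Y) = S.η i X - S.η i Y := fun i X Y => by
    rw [sub_eq_add_neg, S.η_add, eneg, sub_eq_add_neg]
  have g0l : ∀ X, R.g 0 X = 0 := fun X => by simpa using R.g_smul_left 0 0 X
  have g0r : ∀ X, R.g X 0 = 0 := fun X => by rw [R.g_symm, g0l]
  have act0 : ∀ X, D.act X 0 = 0 := fun X => by simpa using D.act_const X 0
  have act1 : ∀ X, D.act X 1 = 0 := fun X => by simpa using D.act_const X 1
  have conn0 : ∀ X, R.conn X 0 = 0 := fun X => by
    simpa [act0] using R.conn_smul_right X 0 0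
  have esum : ∀ k (c : Fin s → C), S.η k (∑ i, c i • S.ξ i) = c k := by
    intro k c
    let L : V →ₗ[C] C := ⟨⟨S.η k, S.η_add k⟩, S.η_smul k⟩
    have : L (∑ i, c i • S.ξ i) = ∑ i, c i * S.η k (S.ξ i) := by
      rw [map_sum]; exact Finset.sum_congr rfl fun i _ => S.η_smul k _ _
    refine this.trans ?_
    simp [S.η_ξ]
  have actd : ∀ X i j, D.act X (S.η i (S.ξ j)) = 0 := by
    intro X i j; rw [S.η_ξ]; split_ifs <;> simp [act0, act1]
  have geta : ∀ X i, R.g X (S.ξ i) = S.η i X := by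
    intro X i
    rw [hcompat, S.f_ξ, g0r]
    simp [S.η_ξ]
  -- antisymmetry
  have anti : ∀ X j k, S.η j (R.conn X (S.ξ k)) = - S.η k (R.conn X (S.ξ j)) := by
    intro X j k
    have h := R.metric_compat X (S.ξ k) (S.ξ j)
    rw [geta, actd, R.g_symm (S.ξ k), geta, geta] at h
    linear_combination -h
  have main : ∀ X j, R.conn X (S.ξ j) = -(α j • S.f X) - β j • S.f (S.f X)
      + ∑ k, S.η k (R.conn X (S.ξ j)) • S.ξ k := by
    intro X j
    have h := hA X (S.ξ j)
    have h2 : - S.f (R.conn X (S.ξ j)) = α j • S.f (S.f X) - β j • S.f X := by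
      unfold nablaF at h
      rw [S.f_ξ, conn0, zero_sub] at h
      rw [h]
      simp only [g0r, geta, S.η_f, zero_smul, zero_add, zero_sub, S.η_ξ, smul_neg]
      rw [Finset.sum_eq_single j]
      · simp [sub_eq_add_neg]
      · intro b _ hb; simp [hb]
      · simp
    have h3 := congrArg S.f h2
    have h4 := S.f_cube X
    rw [fneg, fsub, S.f_smul, S.f_smul, S.f_sq (R.conn X (S.ξ j)),
      eq_neg_of_add_eq_zero_left h4] at h3
    rw [neg_add, neg_neg] at h3
    rw [← smul_neg, ← h3]; abel
  have key : ∀ Y j k, R.g (R.conn (S.ξ j) (S.ξ k)) Y = S.η j (R.conn Y (S.ξ k)) := by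
    intro Y j k
    have h := congrArg (S.η k) (hN (S.ξ j) Y)
    rw [S.η_add, S.η_smul, esum, e0] at h
    unfold nijenhuis dOne at h
    rw [esub, esub, S.η_add, S.f_ξ] at h
    simp only [S.η_f, zero_lie, e0] at h
    rw [actd, ← R.torsion_free, esub, ← geta Y, R.metric_compat, geta] at h
    rw [anti Y j k, R.g_symm]
    linear_combination h - (R.g Y (R.conn (S.ξ j) (S.ξ k)) + S.η k (R.conn Y (S.ξ j))) * half
  have sym : ∀ j k l, S.η j (R.conn (S.ξ l) (S.ξ k)) = S.η l (R.conn (S.ξ j) (S.ξ k)) := by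
    intro j k l
    rw [← key, geta]
  have T0 : ∀ j k l, S.η j (R.conn (S.ξ l) (S.ξ k)) = 0 := by
    intro j k l
    apply two_zero
    have h1 := sym j k l
    have h2 := anti (S.ξ j) l k
    have h3 := sym k l j
    have h4 := anti (S.ξ k) j l
    have h5 := sym l j k
    have h6 := anti (S.ξ l) k j
    linear_combination h1 + h2 - h3 - h4 + h5 + h6
  have A0 : ∀ Y j k, S.η j (R.conn Y (S.ξ k)) = 0 := by
    intro Y j k
    rw [← key, main]
    simp [T0, S.f_ξ, f0, g0l]
  intro X i
  rw [main]
  simp [A0]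
end
end

section
/- An almost trans-S-manifold M with characteristic functions α_i, β_i is a trans-S-manifold (i.e. its structure is normal) if and only if its Levi-Civita connection satisfies ∇_X ξ_i = −α_i fX − β_i f^2 X for every vector field X on M and every i = 1, …, s. -/
open scoped BigOperators

noncomputable section

section Helpers

variable {C V : Type} [CommRing C] [Algebra ℝ C] [LieRing V] [Module C V] {s : ℕ}

def FStr.fL (S : FStr C V s) : V →ₗ[C] V where
  toFun := S.f
  map_add' := S.f_add
  map_smul' := S.f_smul

def FStr.ηL (S : FStr C V s) (i : Fin s) : V →ₗ[C] C where
  toFun := S.η i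
  map_add' := S.η_add i
  map_smul' := S.η_smul i

def RiemStr.gL {D : DiffModel C V} (R : RiemStr D) (Y : V) : V →ₗ[C] C where
  toFun := fun X => R.g X Y
  map_add' := fun X X' => R.g_add_left X X' Y
  map_smul' := fun c X => R.g_smul_left c X Y

theorem f_sub (S : FStr C V s) (X Y : V) : S.f (X - Y) = S.f X - S.f Y := S.fL.map_sub X Y
theorem f_neg (S : FStr C V s) (X : V) : S.f (-X) = -S.f X := S.fL.map_neg X
theorem f_zero (S : FStr C V s) : S.f 0 = 0 := S.fL.map_zero
theorem f_sum (S : FStr C V s) (v : Fin s → V) : S.f (∑ i, v i) = ∑ i, S.f (v i) :=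
  map_sum S.fL v _
theorem η_sub (S : FStr C V s) (i) (X Y : V) : S.η i (X - Y) = S.η i X - S.η i Y :=
  (S.ηL i).map_sub X Y
theorem η_neg (S : FStr C V s) (i) (X : V) : S.η i (-X) = -S.η i X := (S.ηL i).map_neg X
theorem η_zero (S : FStr C V s) (i) : S.η i 0 = 0 := (S.ηL i).map_zero
theorem η_sum (S : FStr C V s) (j) (v : Fin s → V) :
    S.η j (∑ i, v i) = ∑ i, S.η j (v i) :=
  map_sum (S.ηL j) v _
theorem g_subl {D : DiffModel C V} (R : RiemStr D) (X Y Z : V) :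
    R.g (X - Y) Z = R.g X Z - R.g Y Z := (R.gL Z).map_sub X Y
theorem g_negl {D : DiffModel C V} (R : RiemStr D) (X Z : V) :
    R.g (-X) Z = - R.g X Z := (R.gL Z).map_neg X
theorem g_suml {D : DiffModel C V} (R : RiemStr D) (v : Fin s → V) (Z : V) :
    R.g (∑ i, v i) Z = ∑ i, R.g (v i) Z := map_sum (R.gL Z) v _
theorem f3 (S : FStr C V s) (X : V) : S.f (S.f (S.f X)) = - S.f X :=
  eq_neg_of_add_eq_zero_left (S.f_cube X)
theorem g_zerol {D : DiffModel C V} (R : RiemStr D) (Z : V) :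
    R.g 0 Z = 0 := (R.gL Z).map_zero

theorem η_comb (S : FStr C V s) (c : Fin s → C) (j) : S.η j (∑ i, c i • S.ξ i) = c j := by
  simp [η_sum, S.η_smul, S.η_ξ]

theorem g_xi {D : DiffModel C V} {R : RiemStr D} {S : FStr C V s}
    (h : MetricCompat D R S) (X : V) (i) : R.g X (S.ξ i) = S.η i X := by
  rw [h, S.f_ξ, R.g_symm, g_zerol]
  simp [S.η_ξ]

theorem g_f1 {D : DiffModel C V} {R : RiemStr D} {S : FStr C V s}
    (h : MetricCompat D R S) (X Y : V) : R.g (S.f (S.f X)) (S.f Y) = R.g (S.f X) Y := by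
  rw [h (S.f X) Y]
  simp [S.η_f]

theorem g_f2 {D : DiffModel C V} {R : RiemStr D} {S : FStr C V s}
    (h : MetricCompat D R S) (X Y : V) : R.g (S.f (S.f X)) Y = - R.g (S.f X) (S.f Y) := by
  rw [← g_f1 h, f3, g_negl]

theorem g_skew {D : DiffModel C V} {R : RiemStr D} {S : FStr C V s}
    (h : MetricCompat D R S) (X Y : V) : R.g (S.f Y) X = - R.g (S.f X) Y := by
  rw [← g_f1 h, g_f2 h, R.g_symm, g_f1 h]

theorem nab_diff {D : DiffModel C V} {R : RiemStr D} {S : FStr C V s}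
    (h : MetricCompat D R S) {α β : Fin s → C} (hM : IsAlmostTransS D R S α β) (X Y : V) :
    nablaF D R S (S.f X) Y - S.f (nablaF D R S X Y) =
      ∑ i, (α i * R.g (S.f X) Y - β i * R.g (S.f X) (S.f Y)) • S.ξ i := by
  rw [hM, hM, f_sum, ← Finset.sum_sub_distrib]
  refine Finset.sum_congr rfl fun i _ => ?_
  simp only [S.f_add, S.f_smul, f_sub, S.f_ξ, f3, g_f1 h, g_f2 h]
  module

theorem nij_eq {D : DiffModel C V} {R : RiemStr D} {S : FStr C V s}
    (h : MetricCompat D R S) {α β : Fin s → C} (hM : IsAlmostTransS D R S α β) (X Y : V) :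
    nijenhuis S X Y = ∑ i, (2 * (α i * R.g (S.f X) Y)) • S.ξ i := by
  have e : nijenhuis S X Y = (nablaF D R S (S.f X) Y - S.f (nablaF D R S X Y))
      - (nablaF D R S (S.f Y) X - S.f (nablaF D R S Y X)) := by
    simp only [nijenhuis, nablaF, ← R.torsion_free, f_sub]
    abel
  rw [e, nab_diff h hM, nab_diff h hM, ← Finset.sum_sub_distrib]
  refine Finset.sum_congr rfl fun i _ => ?_
  rw [g_skew h X Y, R.g_symm (S.f Y) (S.f X)]
  module

theorem two_d {D : DiffModel C V} {R : RiemStr D} {S : FStr C V s}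
    (h : MetricCompat D R S) (X Y : V) (i) :
    2 * dOne D (S.η i) X Y = R.g (R.conn X (S.ξ i)) Y - R.g (R.conn Y (S.ξ i)) X := by
  have h2 : (2 : C) * algebraMap ℝ C (1 / 2) = 1 := by
    have : (2 : C) = algebraMap ℝ C 2 := (map_ofNat _ 2).symm
    rw [this, ← map_mul]; norm_num
  rw [dOne, ← mul_assoc, h2, one_mul, ← R.torsion_free, η_sub]
  simp only [← g_xi h, R.metric_compat]
  rw [R.g_symm Y, R.g_symm X]
  ring

theorem isNormal_iff_aux {D : DiffModel C V} {R : RiemStr D} {S : FStr C V s}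
    (h : MetricCompat D R S) {α β : Fin s → C} (hM : IsAlmostTransS D R S α β) :
    IsNormal D S ↔ ∀ X Y i, 2 * (α i * R.g (S.f X) Y) +
      (R.g (R.conn X (S.ξ i)) Y - R.g (R.conn Y (S.ξ i)) X) = 0 := by
  have key : ∀ X Y, nijenhuis S X Y + (2 : C) • ∑ i, dOne D (S.η i) X Y • S.ξ i =
      ∑ i, (2 * (α i * R.g (S.f X) Y) +
      (R.g (R.conn X (S.ξ i)) Y - R.g (R.conn Y (S.ξ i)) X)) • S.ξ i := by
    intro X Y
    rw [nij_eq h hM, Finset.smul_sum, ← Finset.sum_add_distrib]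
    refine Finset.sum_congr rfl fun i _ => ?_
    rw [← two_d h]
    module
  constructor
  · intro hN X Y i
    have := hN X Y
    rw [key] at this
    have h2 := congrArg (S.η i) this
    rwa [η_comb, η_zero] at h2
  · intro hN X Y
    rw [key]
    simp [hN]

theorem conn_xi {D : DiffModel C V} {R : RiemStr D} {S : FStr C V s}
    (h : MetricCompat D R S)
    {α β : Fin s → C} (hM : IsAlmostTransS D R S α β) (X : V) (j) :
    R.conn X (S.ξ j) = -(α j • S.f X) - β j • S.f (S.f X)
      + ∑ i, S.η i (R.conn X (S.ξ j)) • S.ξ i := by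
  have c0 : R.conn X 0 = 0 := by
    have := R.conn_smul_right X 0 0
    have h0 : D.act X 0 = 0 := by simpa using D.act_const X 0
    simpa [h0] using this
  have gz : R.g (S.f X) 0 = 0 := by rw [R.g_symm, g_zerol]
  have gx : R.g (S.f X) (S.ξ j) = 0 := by rw [g_xi h, S.η_f]
  have e := hM X (S.ξ j)
  rw [Finset.sum_eq_single j (fun i _ hi => by
    simp [S.f_ξ, gz, gx, S.η_ξ, hi]) (by simp)] at e
  simp only [nablaF, S.f_ξ, c0, S.η_ξ, gz, gx, if_true, zero_smul, one_smul, zero_add,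
    zero_sub] at e
  have e2 := congrArg S.f e
  simp only [S.f_add, S.f_smul, f_neg, f3] at e2
  rw [S.f_sq (R.conn X (S.ξ j))] at e2
  generalize (∑ i, S.η i (R.conn X (S.ξ j)) • S.ξ i) = T at *
  linear_combination (norm := module) e2

end Helpers

/-- An almost trans-`S`-manifold is a trans-`S`-manifold
(i.e. its structure is normal) if and only if
`∇_X ξ_i = −α_i fX − β_i f²X` for every `X` and every `i`. -/
theorem almost_transS_is_transS_iff
    {C V : Type} [CommRing C] [Algebra ℝ C] [LieRing V] [Module C V]
    {s : ℕ} (D : DiffModel C V) (R : RiemStr D) (S : FStr C V s)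
    (hcompat : MetricCompat D R S) (α β : Fin s → C)
    (hM : IsAlmostTransS D R S α β) :
    IsNormal D S ↔
      ∀ (X : V) (i : Fin s),
        R.conn X (S.ξ i) = -(α i • S.f X) - β i • S.f (S.f X) := by
  rw [isNormal_iff_aux hcompat hM]
  have act0 : ∀ X, D.act X 0 = 0 := fun X => by simpa using D.act_const X 0
  have act1 : ∀ X, D.act X 1 = 0 := fun X => by simpa using D.act_const X 1
  constructor
  · intro hN
    -- the vertical part of the connection
    let w : Fin s → Fin s → V → C := fun k i X => S.η k (R.conn X (S.ξ i))
    have hskew : ∀ k i X, w k i X = - w i k X := by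
      intro k i X
      have := R.metric_compat X (S.ξ i) (S.ξ k)
      rw [g_xi hcompat, R.g_symm (S.ξ i), g_xi hcompat, g_xi hcompat, S.η_ξ] at this
      have h0 : D.act X (if k = i then (1 : C) else 0) = 0 := by
        split_ifs <;> simp [act0, act1]
      rw [h0] at this
      simp only [w]
      linear_combination -this
    have hg : ∀ X Y i, R.g (R.conn X (S.ξ i)) Y =
        -(α i * R.g (S.f X) Y) + β i * R.g (S.f X) (S.f Y) + ∑ k, w k i X * S.η k Y := by
      intro X Y i
      rw [conn_xi hcompat hM X i, R.g_add_left, g_subl, g_negl, R.g_smul_left, R.g_smul_left,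
        g_f2 hcompat, g_suml]
      simp only [R.g_smul_left, R.g_symm _ Y, g_xi hcompat, w]
      ring
    have h1 : ∀ X Y i, ∑ k, w k i X * S.η k Y = ∑ k, w k i Y * S.η k X := by
      intro X Y i
      have := hN X Y i
      rw [hg, hg, g_skew hcompat X Y, R.g_symm (S.f Y) (S.f X)] at this
      linear_combination this
    have h2 : ∀ X k i, w k i X = ∑ l, w l i (S.ξ k) * S.η l X := by
      intro X k i
      rw [← h1]
      simp [S.η_ξ]
    have h3 : ∀ k i l, w k i (S.ξ l) = w l i (S.ξ k) := by
      intro k i l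
      rw [h2]
      simp [S.η_ξ]
    have h4 : ∀ k i l, w k i (S.ξ l) = 0 := by
      intro k i l
      have e : w k i (S.ξ l) = - w k i (S.ξ l) := by
        calc w k i (S.ξ l) = w l i (S.ξ k) := h3 ..
          _ = - w i l (S.ξ k) := hskew ..
          _ = - w k l (S.ξ i) := by rw [h3]
          _ = w l k (S.ξ i) := by rw [hskew k l, neg_neg]
          _ = w i k (S.ξ l) := h3 ..
          _ = - w k i (S.ξ l) := hskew ..
      have hh : algebraMap ℝ C (1 / 2) * (2 : C) = 1 := by
        have : (2 : C) = algebraMap ℝ C 2 := (map_ofNat _ 2).symm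
        rw [this, ← map_mul]; norm_num
      linear_combination algebraMap ℝ C (1 / 2) * e - w k i (S.ξ l) * hh
    have h5 : ∀ X k i, w k i X = 0 := by
      intro X k i
      rw [h2]
      simp [h4]
    intro X i
    rw [conn_xi hcompat hM X i]
    have : ∑ k, S.η k (R.conn X (S.ξ i)) • S.ξ k = 0 :=
      Finset.sum_eq_zero fun k _ => by
        have := h5 X k i
        simp only [w] at this
        rw [this, zero_smul]
    rw [this, add_zero]
  · intro hN X Y i
    rw [hN, hN]
    simp only [g_subl, g_negl, R.g_smul_left, g_f2 hcompat]
    rw [g_skew hcompat X Y, R.g_symm (S.f Y) (S.f X)]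
    ring
end
end
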